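/- Let p be a prime, k a finite field of characteristic p, K = k((T)), and fix α ∈ k with Tr_{k/𝔽_p}(α) ≠ 0. Then for every n ≥ 1 and every x ∈ W(K) there exist c ∈ ℤ_p, a finitely supported family (c_i) of elements of W(k) indexed by positive integers i coprime to p, and y, z ∈ W(K), such that x = c·[α] + ∑_i ι(c_i)·[T^{−i}] + ℘y + V^n z. Here [·] is the Teichmüller lift in W(K), ι : W(k) → W(K) is induced by the constant-series embedding k → k((T)), c acts through ℤ_p = W(𝔽_p) → W(K), and V^n is the n-th iterate of the Verschiebung. -/

import Mathlib

theorem PowerSeries.exists_pow_sub_self_eq {R : Type*} [CommRing R] {p : ℕ} (hp : 2 ≤ p)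
    [CharP R p] {g : PowerSeries R} (hg : PowerSeries.constantCoeff g = 0) :
    ∃ y : PowerSeries R, y ^ p - y = g := by
  have hmem : g ∈ Ideal.span {(PowerSeries.X : PowerSeries R)} :=
    Ideal.mem_span_singleton.mpr (PowerSeries.X_dvd_iff.mpr hg)
  have hmonic : (Polynomial.X ^ p - (Polynomial.X + Polynomial.C g)).Monic := by
    nontriviality R
    apply Polynomial.monic_X_pow_sub
    rw [Polynomial.degree_X_add_C]
    exact_mod_cast hp
  obtain ⟨y, hy, -⟩ := HenselianRing.is_henselian
    (I := Ideal.span {(PowerSeries.X : PowerSeries R)})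
    _ hmonic 0 (by simpa [show p ≠ 0 by omega] using hmem)
    (by
      have h : (p : PowerSeries R) = 0 := by
        rw [← map_natCast (PowerSeries.C (R := R)), CharP.cast_eq_zero, map_zero]
      simp [Polynomial.derivative_X_pow, h])
  refine ⟨y, ?_⟩
  simp only [Polynomial.IsRoot, Polynomial.eval_sub, Polynomial.eval_pow, Polynomial.eval_X,
    Polynomial.eval_add, Polynomial.eval_C] at hy
  linear_combination hy

/-- Over a finite field, an element of nonzero trace spans a complement of the image of the
Artin–Schreier map. -/
theorem FiniteField.exists_eq_mul_add_pow_sub_self {p : ℕ} [Fact p.Prime] {k : Type*} [Field k]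
    [Finite k] [Algebra (ZMod p) k] {α : k} (hα : Algebra.trace (ZMod p) k α ≠ 0) (b : k) :
    ∃ (c : ZMod p) (y : k), b = algebraMap (ZMod p) k c * α + (y ^ p - y) := by
  let φ : k →ₐ[ZMod p] k := FiniteField.frobeniusAlgHom (ZMod p) k
  have hφ (y : k) : φ y = y ^ p := by
    simp [φ, ZMod.card]
  let P : k →ₗ[ZMod p] k := φ.toLinearMap - LinearMap.id
  have hP (y : k) : P y = y ^ p - y := by simp [P, hφ]
  have htr (y : k) : Algebra.trace (ZMod p) k (φ y) = Algebra.trace (ZMod p) k y :=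
    Algebra.trace_eq_of_algEquiv
      (AlgEquiv.ofBijective φ (Finite.injective_iff_bijective.mp φ.injective)) y
  have hker : LinearMap.ker P ≤ Submodule.span (ZMod p) {1} := by
    intro y hy
    rw [LinearMap.mem_ker, hP, sub_eq_zero] at hy
    have : CharP k p := charP_of_injective_algebraMap' (ZMod p) p
    obtain ⟨m, rfl⟩ := (mem_bot_iff_intCast p k).mp
      ((Subfield.mem_bot_iff_pow_eq_self k p).mpr hy)
    exact Submodule.mem_span_singleton.mpr ⟨m, by rw [Algebra.smul_def, mul_one, map_intCast]⟩
  have hle : LinearMap.range P ≤ LinearMap.ker (Algebra.trace (ZMod p) k) := by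
    rintro _ ⟨y, rfl⟩
    rw [LinearMap.mem_ker, show P y = φ y - y from rfl, map_sub, htr, sub_self]
  have heq : LinearMap.range P = LinearMap.ker (Algebra.trace (ZMod p) k) := by
    apply Submodule.eq_of_le_of_finrank_le hle
    have h₁ := (Submodule.finrank_mono hker).trans (finrank_span_le_card {1})
    rw [Set.toFinset_singleton, Finset.card_singleton] at h₁
    have h₂ := LinearMap.finrank_range_add_finrank_ker P
    have h₃ := LinearMap.finrank_range_add_finrank_ker (Algebra.trace (ZMod p) k)
    have h₄ : 0 < Module.finrank (ZMod p) (LinearMap.range (Algebra.trace (ZMod p) k)) :=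
      Module.finrank_pos_iff_exists_ne_zero.mpr ⟨⟨_, α, rfl⟩, fun h => hα (congrArg Subtype.val h)⟩
    omega
  have hb : b ∈ Submodule.span (ZMod p) {α} ⊔ LinearMap.range P := by
    rw [heq, LinearMap.span_singleton_sup_ker_eq_top _ hα]
    trivial
  obtain ⟨_, hc, _, ⟨y, rfl⟩, rfl⟩ := Submodule.mem_sup.mp hb
  obtain ⟨c, rfl⟩ := Submodule.mem_span_singleton.mp hc
  exact ⟨c, y, by rw [hP, Algebra.smul_def]⟩

theorem HahnSeries.ofPowerSeries_mk_coeff_natCast {R : Type*} [Semiring R] (f : LaurentSeries R)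
    (hf : ∀ j < 0, f.coeff j = 0) :
    HahnSeries.ofPowerSeries ℤ R (PowerSeries.mk fun n => f.coeff n) = f := by
  ext j
  rw [PowerSeries.coeff_coe]
  split_ifs with h
  · rw [hf j h]
  · rw [PowerSeries.coeff_mk, Int.natAbs_of_nonneg (not_lt.mp h)]

theorem WittVector.exists_verschiebung_eq {p : ℕ} [Fact p.Prime] {R : Type*} [CommRing R]
    (x : WittVector p R) (hx : x.coeff 0 = 0) : ∃ z, WittVector.verschiebung z = x := by
  refine ⟨WittVector.mk p fun n => x.coeff (n + 1), ?_⟩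
  ext n
  cases n with
  | zero => rw [WittVector.verschiebung_coeff_zero, hx]
  | succ n => rw [WittVector.verschiebung_coeff_succ]; rfl

/-- If an additive submonoid `S` of `W(R)` contains all `F x - x` and every Witt vector is
congruent to an element of `S` modulo `V`, then the same holds modulo each power of `V`. -/
theorem WittVector.exists_mem_add_iterate_verschiebung {p : ℕ} [Fact p.Prime] {R : Type*}
    [CommRing R] [CharP R p] (S : AddSubmonoid (WittVector p R))
    (hF : ∀ x, WittVector.frobenius x - x ∈ S)
    (hS : ∀ r : R, ∃ s ∈ S, s.coeff 0 = r) (n : ℕ) (x : WittVector p R) :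
    ∃ s ∈ S, ∃ z, x = s + (WittVector.verschiebung)^[n] z := by
  have hV (x : WittVector p R) : ∃ s ∈ S, ∃ z, x = s + WittVector.verschiebung z := by
    obtain ⟨s, hs, h⟩ := hS (x.coeff 0)
    obtain ⟨z, hz⟩ := WittVector.exists_verschiebung_eq (x - s) (by
      change WittVector.constantCoeff (x - s) = 0
      rw [map_sub, sub_eq_zero]
      exact h.symm)
    exact ⟨s, hs, z, by rw [hz]; ring⟩
  have hFn (m : ℕ) (w : WittVector p R) : w - (WittVector.frobenius)^[m] w ∈ S := by
    induction m with
    | zero => simp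
    | succ m ih =>
      have := S.add_mem ih (hF (-(WittVector.frobenius)^[m] w))
      rw [Function.iterate_succ_apply']
      convert this using 1
      rw [map_neg]; ring
  have hVF : Function.Commute (WittVector.verschiebung : WittVector p R → WittVector p R)
      WittVector.frobenius := WittVector.verschiebung_frobenius_comm
  induction n with
  | zero => exact ⟨0, S.zero_mem, x, by simp⟩
  | succ n ih =>
    obtain ⟨s, hs, z, rfl⟩ := ih
    obtain ⟨t, ht, w, rfl⟩ := hV z
    refine ⟨s + (_ + p ^ n • t), S.add_mem hs (S.add_mem (hFn n
      ((WittVector.verschiebung)^[n] (t + WittVector.verschiebung w))) (S.nsmul_mem ht _)),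
      (WittVector.frobenius)^[n] w, ?_⟩
    have h (v : WittVector p R) : (WittVector.frobenius)^[n] ((WittVector.verschiebung)^[n] v)
        = p ^ n • v := by
      rw [← (hVF.iterate_iterate n n).eq, WittVector.iterate_verschiebung_iterate_frobenius]
      simp [mul_comm]
    rw [h, Function.iterate_succ_apply, hVF.iterate_right n w, (hVF.iterate_iterate n n).eq, h]
    rw [smul_add]; ring

section LaurentSeries

variable (p : ℕ) [Fact p.Prime] {k : Type*} [Field k] [CharP k p]

/-- The Witt vectors over `k((T))` of the form `c·[α] + ∑_i ι(c_i)·[T^{-i}] + ℘y`. -/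
def WittVector.representableLaurent (α : k) : AddSubmonoid (WittVector p (LaurentSeries k)) where
  carrier := {x | ∃ (c : WittVector p (ZMod p)) (a : ℕ →₀ WittVector p k)
      (y : WittVector p (LaurentSeries k)),
      (∀ i ∈ a.support, 0 < i ∧ ¬ p ∣ i) ∧
      x = WittVector.map ((HahnSeries.C : k →+* LaurentSeries k).comp
              (ZMod.castHom (dvd_refl p) k)) c
            * WittVector.teichmuller p (HahnSeries.C α)
        + (a.sum fun i d =>
            WittVector.map (HahnSeries.C : k →+* LaurentSeries k) d
              * WittVector.teichmuller p (HahnSeries.single (-(i : ℤ)) 1))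
        + (WittVector.frobenius y - y)}
  zero_mem' := ⟨0, 0, 0, by simp, by simp⟩
  add_mem' := by
    classical
    rintro _ _ ⟨c, a, y, ha, rfl⟩ ⟨c', a', y', ha', rfl⟩
    refine ⟨c + c', a + a', y + y', fun i hi => ?_, ?_⟩
    · exact (Finset.mem_union.mp (Finsupp.support_add hi)).elim (ha i) (ha' i)
    · rw [Finsupp.sum_add_index' (by simp) (by intros; rw [map_add, add_mul])]
      simp only [map_add]
      ring

variable {p}

theorem WittVector.frobenius_sub_self_mem_representableLaurent (α : k)
    (y : WittVector p (LaurentSeries k)) :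
    WittVector.frobenius y - y ∈ WittVector.representableLaurent p α :=
  ⟨0, 0, y, by simp, by simp⟩

theorem WittVector.exists_mem_representableLaurent_coeff_zero_eq [Finite k] [Algebra (ZMod p) k]
    {α : k} (hα : Algebra.trace (ZMod p) k α ≠ 0) (f : LaurentSeries k) :
    ∃ s ∈ WittVector.representableLaurent p α, s.coeff 0 = f := by
  have : CharP (LaurentSeries k) p := charP_of_injective_ringHom HahnSeries.C_injective p
  have hp : p.Prime := Fact.out
  let S₀ := (WittVector.representableLaurent p α).map
    (WittVector.constantCoeff : WittVector p (LaurentSeries k) →+* LaurentSeries k).toAddMonoidHom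
  have hS₀ {s} (hs : s ∈ WittVector.representableLaurent p α) {r}
      (h : WittVector.constantCoeff s = r) : r ∈ S₀ := ⟨s, hs, h⟩
  change f ∈ S₀
  have hAS (y : LaurentSeries k) : y ^ p - y ∈ S₀ := by
    refine hS₀ (WittVector.frobenius_sub_self_mem_representableLaurent α
      (WittVector.teichmuller p y)) ?_
    rw [map_sub]
    change (WittVector.frobenius (WittVector.teichmuller p y)).coeff 0 -
      (WittVector.teichmuller p y).coeff 0 = _
    rw [WittVector.coeff_frobenius_charP, WittVector.teichmuller_coeff_zero]
  have hα' (c : ZMod p) : HahnSeries.C (algebraMap (ZMod p) k c * α) ∈ S₀ := by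
    refine hS₀ ⟨WittVector.teichmuller p c, 0, 0, by simp, rfl⟩ ?_
    simp only [WittVector.map_teichmuller, Finsupp.sum_zero_index, map_zero, sub_zero, add_zero,
      ← map_mul]
    rw [Subsingleton.elim (ZMod.castHom (dvd_refl p) k) (algebraMap (ZMod p) k)]
    exact (WittVector.teichmuller_coeff_zero p _).trans (map_mul HahnSeries.C _ _).symm
  have hC (b : k) : HahnSeries.C b ∈ S₀ := by
    obtain ⟨c, y, rfl⟩ := FiniteField.exists_eq_mul_add_pow_sub_self hα b
    rw [map_add, map_sub, map_pow]
    exact S₀.add_mem (hα' c) (hAS _)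
  have hneg (j : ℕ) : 0 < j → ∀ b : k, HahnSeries.single (-(j : ℤ)) b ∈ S₀ := by
    induction j using Nat.strong_induction_on with
    | _ j ih =>
      intro hj b
      by_cases hpj : p ∣ j
      · obtain ⟨i, rfl⟩ := hpj
        have hi : 0 < i := Nat.pos_of_mul_pos_left hj
        obtain ⟨d, rfl⟩ := (_root_.frobeniusEquiv k p).surjective b
        have := S₀.add_mem (hAS (HahnSeries.single (-(i : ℤ)) d))
          (ih i (by nlinarith [hp.two_le]) hi d)
        rw [sub_add_cancel, HahnSeries.single_pow] at this
        simpa [frobeniusEquiv_apply, frobenius_def] using this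
      · refine hS₀ ⟨0, Finsupp.single j (WittVector.teichmuller p b), 0, ?_, rfl⟩ ?_
        · intro i hi
          rw [Finset.mem_singleton.mp (Finsupp.support_single_subset hi)]
          exact ⟨hj, hpj⟩
        · rw [Finsupp.sum_single_index (by simp)]
          simp only [WittVector.map_teichmuller, map_zero, sub_zero, add_zero, zero_mul, zero_add,
            ← map_mul]
          refine (WittVector.teichmuller_coeff_zero p _).trans ?_
          simp [HahnSeries.C_apply]
  have hint (f : LaurentSeries k) (hf : ∀ j < 0, f.coeff j = 0) : f ∈ S₀ := by
    rw [← HahnSeries.ofPowerSeries_mk_coeff_natCast f hf]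
    set g : PowerSeries k := PowerSeries.mk fun n => f.coeff n
    obtain ⟨y, hy⟩ := PowerSeries.exists_pow_sub_self_eq hp.two_le
      (g := g - PowerSeries.C (PowerSeries.constantCoeff g)) (by simp)
    rw [sub_eq_iff_eq_add.mp hy.symm, map_add, map_sub, map_pow, HahnSeries.ofPowerSeries_C]
    exact S₀.add_mem (hAS _) (hC _)
  have hbdd (m : ℕ) : ∀ f : LaurentSeries k, (∀ j : ℤ, j < -m → f.coeff j = 0) → f ∈ S₀ := by
    induction m with
    | zero => exact fun f hf => hint f (by simpa using hf)
    | succ m ih =>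
      intro f hf
      rw [← sub_add_cancel f
        (HahnSeries.single (-((m + 1 : ℕ) : ℤ)) (f.coeff (-((m + 1 : ℕ) : ℤ))))]
      refine S₀.add_mem (ih _ fun j hj => ?_) (hneg _ m.succ_pos _)
      rw [HahnSeries.coeff_sub, HahnSeries.coeff_single]
      split_ifs with h
      · rw [h, sub_self]
      · rw [sub_zero]
        exact hf j (by push_cast at h ⊢; omega)
  exact hbdd f.order.natAbs f fun j hj => HahnSeries.coeff_eq_zero_of_lt_order (by omega)

end LaurentSeries


/-- Let `p` be a prime, `k` a finite field of characteristic `p`,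
`K = k((T))`, and `α ∈ k` with `Tr_{k/𝔽_p}(α) ≠ 0`.  Then for every `n ≥ 1` and every
`x ∈ W(K)` there are `c ∈ ℤ_p = W(𝔽_p)`, a finitely supported family `(c_i)` of elements of
`W(k)` indexed by positive integers `i` coprime to `p`, and `y, z ∈ W(K)` with
`x = c·[α] + ∑_i ι(c_i)·[T^{-i}] + ℘y + Vⁿz`, where `[·]` is the Teichmüller lift,
`ι : W(k) → W(K)` is induced by the constant-series embedding, and `V` is the Verschiebung. -/
theorem localField_wittVector_representation (p : ℕ) [Fact p.Prime]
    (k : Type*) [Field k] [Fintype k] [CharP k p] [Algebra (ZMod p) k]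
    (α : k) (hα : Algebra.trace (ZMod p) k α ≠ 0)
    (n : ℕ) (hn : 1 ≤ n) (x : WittVector p (LaurentSeries k)) :
    ∃ (c : WittVector p (ZMod p)) (a : ℕ →₀ WittVector p k)
      (y z : WittVector p (LaurentSeries k)),
      (∀ i ∈ a.support, 0 < i ∧ ¬ p ∣ i) ∧
      x = WittVector.map ((HahnSeries.C : k →+* LaurentSeries k).comp
              (ZMod.castHom (dvd_refl p) k)) c
            * WittVector.teichmuller p (HahnSeries.C α)
        + (a.sum fun i d =>
            WittVector.map (HahnSeries.C : k →+* LaurentSeries k) d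
              * WittVector.teichmuller p (HahnSeries.single (-(i : ℤ)) 1))
        + (WittVector.frobenius y - y)
        + (fun v : WittVector p (LaurentSeries k) => WittVector.verschiebung v)^[n] z := by
  have : CharP (LaurentSeries k) p := charP_of_injective_ringHom HahnSeries.C_injective p
  obtain ⟨_, ⟨c, a, y, ha, rfl⟩, z, rfl⟩ := WittVector.exists_mem_add_iterate_verschiebung
    (WittVector.representableLaurent p α)
    (WittVector.frobenius_sub_self_mem_representableLaurent α)
    (WittVector.exists_mem_representableLaurent_coeff_zero_eq hα) n x
  exact ⟨c, a, y, z, ha, rfl⟩
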